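/- There exists a universal constant c > 0 with the following property. Let p ∈ [1,2], θ ∈ (0,1), let X be a finite-dimensional real normed space of dimension d ≥ 1 having Rademacher type p with constant T, let n ≥ 1, and suppose f : {-1,1}^n → X satisfies s·ρ(x,y)^θ ≤ ‖f(x) − f(y)‖_X ≤ s·D·ρ(x,y)^θ for all x,y ∈ {-1,1}^n, for some s > 0 and D ≥ 1. Then D ≥ c · n^θ / (T · min(n, d)^{1/p}). -/

import Mathlib

open Finset

noncomputable section

/-- The real sign of a Boolean coordinate: `true ↦ 1`, `false ↦ -1`. -/
def sgn (b : Bool) : ℝ := if b then 1 else -1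

/-- Hamming distance on the discrete cube `{-1,1}^n ≃ Bool^n`. -/
def hamming {n : ℕ} (x y : Fin n → Bool) : ℕ :=
  (Finset.univ.filter fun i => x i ≠ y i).card

/-- Flip the `i`-th coordinate. -/
def flipc {ι : Type*} [DecidableEq ι] (x : ι → Bool) (i : ι) : ι → Bool :=
  Function.update x i (!(x i))

/-- Negate all coordinates (the antipodal map). -/
def negc {ι : Type*} (x : ι → Bool) : ι → Bool := fun i => !(x i)

/-- `X` has Rademacher type `p` with constant `T`. -/
def RademacherType (X : Type*) [NormedAddCommGroup X] [NormedSpace ℝ X] (p T : ℝ) : Prop :=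
  ∀ (m : ℕ) (v : Fin m → X),
    (2 ^ m : ℝ)⁻¹ * ∑ x : Fin m → Bool, ‖∑ i, sgn (x i) • v i‖ ^ p ≤
      T ^ p * ∑ i, ‖v i‖ ^ p

/-- `X` has cotype `q` with constant `Cq`. -/
def CotypeC (X : Type*) [NormedAddCommGroup X] [NormedSpace ℝ X] (q Cq : ℝ) : Prop :=
  ∀ (m : ℕ) (v : Fin m → X),
    (∑ i, ‖v i‖ ^ q) / Cq ^ q ≤
      (2 ^ m : ℝ)⁻¹ * ∑ x : Fin m → Bool, ‖∑ i, sgn (x i) • v i‖ ^ q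

open scoped Classical in
/-- The weak `ℓ_p` norm of a finite real vector. -/
def weakLp {ι : Type*} [Fintype ι] (p : ℝ) (w : ι → ℝ) : ℝ :=
  sSup {z | ∃ r : ℝ, 0 ≤ r ∧
    z = r * ((Finset.univ.filter fun i => r ≤ |w i|).card : ℝ) ^ (1 / p)}

/-- Metric stable type `p` with constant `S`. -/
def MetricStableType (M : Type*) [PseudoMetricSpace M] (p S : ℝ) : Prop :=
  ∀ (n : ℕ) (f : (Fin n → Bool) → M),
    (2 ^ n : ℝ)⁻¹ * ∑ x : Fin n → Bool, dist (f x) (f (negc x)) ^ p ≤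
      S ^ p * ((2 ^ n : ℝ)⁻¹ *
        ∑ x : Fin n → Bool, weakLp p (fun i => (1 / 2) * dist (f x) (f (flipc x i))) ^ p)

/-- The product biased measure weight of a point of the cube. -/
def biasedWeight {ι : Type*} [Fintype ι] (α : ι → ℝ) (x : ι → Bool) : ℝ :=
  ∏ i, if x i then α i else 1 - α i

/-- The biased discrete partial derivative `∂_i^α`. -/
def bder {ι : Type*} [DecidableEq ι] {X : Type*} [AddCommGroup X] [Module ℝ X]
    (α : ℝ) (i : ι) (f : (ι → Bool) → X) (x : ι → Bool) : X :=
  f x - (α • f (Function.update x i true) + (1 - α) • f (Function.update x i false))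

/-- The `L_p(μ; X)` norm with respect to the weight `μ` on the cube. -/
def lpNormW {ι : Type*} [Fintype ι] [DecidableEq ι] {X : Type*} [NormedAddCommGroup X]
    (μ : (ι → Bool) → ℝ) (p : ℝ) (g : (ι → Bool) → X) : ℝ :=
  (∑ x : ι → Bool, μ x * ‖g x‖ ^ p) ^ (1 / p)

/-- The Orlicz `L_p(log L)^{p/2}(μ; X)` norm with respect to the weight `μ` on the cube. -/
def orliczNormW {ι : Type*} [Fintype ι] [DecidableEq ι] {X : Type*} [NormedAddCommGroup X]
    (μ : (ι → Bool) → ℝ) (p : ℝ) (g : (ι → Bool) → X) : ℝ :=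
  sInf {γ : ℝ | 0 < γ ∧
    ∑ x : ι → Bool, (μ x * (‖g x‖ ^ p / γ ^ p)) *
      Real.log (Real.exp 1 + ‖g x‖ ^ p / γ ^ p) ^ (p / 2) ≤ 1}

/-- The one-dimensional transition kernel `p_t^α`. -/
def ptrans (t α : ℝ) : Bool → Bool → ℝ := fun a b =>
  match a, b with
  | true, true => 1 - (1 - Real.exp (-t)) * (1 - α)
  | true, false => (1 - Real.exp (-t)) * (1 - α)
  | false, true => (1 - Real.exp (-t)) * α
  | false, false => 1 - (1 - Real.exp (-t)) * α

/-- The matrix `η_t^α(·,·;θ)`. -/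
def eta (t α θ : ℝ) : Bool → Bool → ℝ := fun a b =>
  match a, b with
  | true, true => (Real.exp (-t) - θ) / ptrans t α true true
  | true, false => (-θ) / ptrans t α false true
  | false, true => (θ - Real.exp (-t)) / ptrans t α true false
  | false, false => θ / ptrans t α false false

/-- The product transition kernel `p_t^𝛂`. -/
def pprod {n : ℕ} (t : ℝ) (α : Fin n → ℝ) (x y : Fin n → Bool) : ℝ :=
  ∏ i, ptrans t (α i) (x i) (y i)

/-- Glue coordinates on `σ` (given by `x`) with coordinates off `σ` (given by `w`). -/
def glue {n : ℕ} (σ : Finset (Fin n)) (x : {i // i ∈ σ} → Bool) (w : Fin n → Bool) :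
    Fin n → Bool := fun j => if h : j ∈ σ then x ⟨j, h⟩ else w j

/-- The low-dimensional skeleton `𝒞_d^n` of the solid cube `[-1,1]^n`. -/
def cubeSkeleton (n d : ℕ) : Set (Fin n → ℝ) :=
  {x | (∀ i, |x i| ≤ 1) ∧ n - d ≤ {i | |x i| = 1}.ncard}

/-- The `ℓ_p^d` norm on `ℝ^d`. -/
def lpnorm (p : ℝ) {d : ℕ} (v : Fin d → ℝ) : ℝ := (∑ k, |v k| ^ p) ^ (1 / p)

section NoiseOperator

variable {n : ℕ}

lemma sgn_mul_self (b : Bool) : sgn b * sgn b = 1 := by cases b <;> simp [sgn]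

lemma sgn_not (b : Bool) : sgn (!b) = -sgn b := by cases b <;> simp [sgn]

/-- Coordinatewise product of two points of the cube, under `true ↦ 1`, `false ↦ -1`. -/
def mulc (x y : Fin n → Bool) : Fin n → Bool := fun i => x i == y i

/-- The law of a random point of the cube with independent coordinates of mean `r`. -/
def noiseWeight (r : ℝ) (ξ : Fin n → Bool) : ℝ := ∏ i, (1 + r * sgn (ξ i)) / 2

lemma noiseWeight_nonneg {r : ℝ} (h0 : 0 ≤ r) (h1 : r ≤ 1) (ξ : Fin n → Bool) :
    0 ≤ noiseWeight r ξ := by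
  refine Finset.prod_nonneg fun i _ => ?_
  cases ξ i <;> simp [sgn] <;> linarith

lemma sum_cube_prod (g : Fin n → Bool → ℝ) :
    ∑ ξ : Fin n → Bool, ∏ i, g i (ξ i) = ∏ i, (g i true + g i false) := by
  have h := Finset.prod_univ_sum (fun _ : Fin n => (Finset.univ : Finset Bool)) g
  rw [Fintype.piFinset_univ] at h
  rw [← h]
  simp

lemma sum_noiseWeight (r : ℝ) : ∑ ξ : Fin n → Bool, noiseWeight r ξ = 1 := by
  unfold noiseWeight
  rw [sum_cube_prod (fun _ b => (1 + r * sgn b) / 2)]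
  refine Finset.prod_eq_one fun i _ => ?_
  simp [sgn]
  ring

/-- The contribution of the `i`-th coordinate to the derivative of `noiseWeight r ξ` in `r`. -/
def noiseWeightDeriv (r : ℝ) (i : Fin n) (ξ : Fin n → Bool) : ℝ :=
  (∏ j ∈ Finset.univ.erase i, (1 + r * sgn (ξ j)) / 2) * (sgn (ξ i) / 2)

lemma noiseWeight_mul_sub (r : ℝ) (i : Fin n) (ξ : Fin n → Bool) :
    noiseWeight r ξ * (sgn (ξ i) - r) = (1 - r ^ 2) * noiseWeightDeriv r i ξ := by
  unfold noiseWeight noiseWeightDeriv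
  rw [← Finset.mul_prod_erase Finset.univ _ (Finset.mem_univ i)]
  linear_combination ((∏ j ∈ Finset.univ.erase i, (1 + r * sgn (ξ j)) / 2) * r / 2) *
    sgn_mul_self (ξ i)

lemma hasDerivAt_noiseWeight (r : ℝ) (ξ : Fin n → Bool) :
    HasDerivAt (fun r => noiseWeight r ξ) (∑ i, noiseWeightDeriv r i ξ) r := by
  have h : ∀ i ∈ (Finset.univ : Finset (Fin n)),
      HasDerivAt (fun r : ℝ => (1 + r * sgn (ξ i)) / 2) (sgn (ξ i) / 2) r := by
    intro i _
    simpa using (((hasDerivAt_id r).mul_const (sgn (ξ i))).const_add 1).div_const 2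
  simpa [noiseWeight, noiseWeightDeriv, smul_eq_mul] using HasDerivAt.fun_finsetProd h

lemma flipc_flipc (x : Fin n → Bool) (i : Fin n) : flipc (flipc x i) i = x := by
  simp [flipc]

lemma sum_flipc {M : Type*} [AddCommMonoid M] (i : Fin n) (g : (Fin n → Bool) → M) :
    ∑ x, g (flipc x i) = ∑ x, g x :=
  Equiv.sum_comp (Function.Involutive.toPerm (fun x => flipc x i)
    (fun x => flipc_flipc x i)) g

lemma noiseWeightDeriv_flipc (r : ℝ) (i : Fin n) (ξ : Fin n → Bool) :
    noiseWeightDeriv r i (flipc ξ i) = -noiseWeightDeriv r i ξ := by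
  unfold noiseWeightDeriv
  have h : ∏ j ∈ Finset.univ.erase i, (1 + r * sgn (flipc ξ i j)) / 2 =
      ∏ j ∈ Finset.univ.erase i, (1 + r * sgn (ξ j)) / 2 := by
    refine Finset.prod_congr rfl fun j hj => ?_
    simp [flipc, Function.update_of_ne (Finset.ne_of_mem_erase hj)]
  rw [h]
  simp only [flipc, Function.update_self, sgn_not]
  ring

variable {X : Type*} [NormedAddCommGroup X] [NormedSpace ℝ X]

lemma sum_noiseWeightDeriv_smul_eq_zero (r : ℝ) (i : Fin n) (g : (Fin n → Bool) → X)
    (hg : ∀ ξ, g (flipc ξ i) = g ξ) :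
    ∑ ξ, noiseWeightDeriv r i ξ • g ξ = 0 := by
  have h := sum_flipc i (fun ξ => noiseWeightDeriv r i ξ • g ξ)
  simp only [noiseWeightDeriv_flipc, hg, neg_smul, Finset.sum_neg_distrib] at h
  have h2 : (2 : ℝ) • ∑ ξ, noiseWeightDeriv r i ξ • g ξ = 0 := by
    rw [two_smul]
    nth_rewrite 1 [← h]
    exact neg_add_cancel _
  exact (smul_eq_zero.mp h2).resolve_left two_ne_zero

lemma sum_noiseWeight_mul_sgn (r : ℝ) (i : Fin n) :
    ∑ ξ : Fin n → Bool, noiseWeight r ξ * sgn (ξ i) = r := by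
  have h : ∑ ξ : Fin n → Bool, noiseWeight r ξ * (sgn (ξ i) - r) = 0 := by
    simp only [noiseWeight_mul_sub, ← Finset.mul_sum]
    have := sum_noiseWeightDeriv_smul_eq_zero r i (fun _ => (1 : ℝ)) (fun _ => rfl)
    simp only [smul_eq_mul, mul_one] at this
    rw [this, mul_zero]
  simp only [mul_sub, Finset.sum_sub_distrib, ← Finset.sum_mul, sum_noiseWeight] at h
  linarith

lemma norm_sum_sgn_sub_le (r : ℝ) (h0 : 0 ≤ r) (h1 : r ≤ 1) (v : Fin n → X)
    (ξ : Fin n → Bool) :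
    ‖∑ i, (sgn (ξ i) - r) • v i‖ ≤
      ∑ ζ : Fin n → Bool, noiseWeight r ζ * ‖∑ i, (sgn (ξ i) - sgn (ζ i)) • v i‖ := by
  have h : ∑ i, (sgn (ξ i) - r) • v i =
      ∑ ζ : Fin n → Bool, noiseWeight r ζ • ∑ i, (sgn (ξ i) - sgn (ζ i)) • v i := by
    simp only [Finset.smul_sum, smul_smul]
    rw [Finset.sum_comm]
    refine Finset.sum_congr rfl fun i _ => ?_
    rw [← Finset.sum_smul]
    congr 1
    simp only [mul_sub, Finset.sum_sub_distrib, ← Finset.sum_mul, sum_noiseWeight,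
      sum_noiseWeight_mul_sgn, one_mul]
  rw [h]
  refine (norm_sum_le _ _).trans (Finset.sum_le_sum fun ζ _ => ?_)
  rw [norm_smul, Real.norm_of_nonneg (noiseWeight_nonneg h0 h1 ζ)]

/-- Exchange the coordinates of two points of the cube where `ε` is `false`. -/
def swapc (ε : Fin n → Bool) (q : (Fin n → Bool) × (Fin n → Bool)) :
    (Fin n → Bool) × (Fin n → Bool) :=
  (fun i => if ε i then q.1 i else q.2 i, fun i => if ε i then q.2 i else q.1 i)

lemma swapc_involutive (ε : Fin n → Bool) : Function.Involutive (swapc ε) := by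
  intro q
  unfold swapc
  ext i <;> by_cases h : ε i <;> simp [h]

lemma sum_prod_noiseWeight_eq_signed (r : ℝ) (v : Fin n → X) (ε : Fin n → Bool) :
    ∑ q : (Fin n → Bool) × (Fin n → Bool), noiseWeight r q.1 * noiseWeight r q.2 *
        ‖∑ i, (sgn (q.1 i) - sgn (q.2 i)) • v i‖ =
      ∑ q : (Fin n → Bool) × (Fin n → Bool), noiseWeight r q.1 * noiseWeight r q.2 *
        ‖∑ i, sgn (ε i) • (sgn (q.1 i) - sgn (q.2 i)) • v i‖ := by
  rw [← Equiv.sum_comp (swapc_involutive ε).toPerm]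
  refine Finset.sum_congr rfl fun q _ => ?_
  simp only [Function.Involutive.coe_toPerm]
  congr 1
  · simp only [noiseWeight, ← Finset.prod_mul_distrib]
    refine Finset.prod_congr rfl fun i _ => ?_
    by_cases h : ε i <;> simp [swapc, h]
    ring
  · congr 1
    refine Finset.sum_congr rfl fun i _ => ?_
    by_cases h : ε i <;> simp [swapc, h, sgn]
    rw [← neg_smul, neg_sub]

lemma abs_sgn_sub_rpow {p : ℝ} (hp : 0 < p) (a b : Bool) :
    |sgn a - sgn b| ^ p = 2 ^ p * ((1 - sgn a * sgn b) / 2) := by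
  cases a <;> cases b <;> norm_num [sgn, Real.zero_rpow hp.ne']

/-- Biased Rademacher sums of bounded vectors in a space of type `p`. -/
lemma RademacherType.sum_noiseWeight_mul_norm_le {p T : ℝ} (hp1 : 1 ≤ p) (hp2 : p ≤ 2)
    (hT : 0 < T) (hX : RademacherType X p T) {r : ℝ} (h0 : 0 ≤ r) (h1 : r ≤ 1)
    (v : Fin n → X) {L : ℝ} (hL : 0 ≤ L) (hv : ∀ i, ‖v i‖ ≤ L) :
    ∑ ξ : Fin n → Bool, noiseWeight r ξ * ‖∑ i, (sgn (ξ i) - r) • v i‖ ≤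
      2 * T * L * (n : ℝ) ^ (1 / p) * √(1 - r ^ 2) := by
  have hp0 : 0 < p := by linarith
  have hr : 0 ≤ 1 - r ^ 2 := by nlinarith
  set W : (Fin n → Bool) × (Fin n → Bool) → ℝ :=
    fun q => noiseWeight r q.1 * noiseWeight r q.2 with hW
  set u : (Fin n → Bool) × (Fin n → Bool) → Fin n → X :=
    fun q i => (sgn (q.1 i) - sgn (q.2 i)) • v i with hu
  have hW0 : ∀ q, 0 ≤ W q := fun q =>
    mul_nonneg (noiseWeight_nonneg h0 h1 _) (noiseWeight_nonneg h0 h1 _)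
  have hW1 : ∑ q, W q = 1 := by
    rw [hW, Fintype.sum_prod_type]
    simp only [← Finset.mul_sum, sum_noiseWeight, mul_one]
  have hc : (∑ _ε : Fin n → Bool, (2 ^ n : ℝ)⁻¹) = 1 := by simp
  have hsym : ∑ ξ : Fin n → Bool, noiseWeight r ξ * ‖∑ i, (sgn (ξ i) - r) • v i‖ ≤
      ∑ q, W q * ‖∑ i, u q i‖ := by
    rw [Fintype.sum_prod_type]
    refine Finset.sum_le_sum fun ξ _ => ?_
    simp only [hW, hu, mul_assoc, ← Finset.mul_sum]
    exact mul_le_mul_of_nonneg_left (norm_sum_sgn_sub_le r h0 h1 v ξ)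
      (noiseWeight_nonneg h0 h1 ξ)
  have hsign : ∑ q, W q * ‖∑ i, u q i‖ =
      ∑ z : (Fin n → Bool) × ((Fin n → Bool) × (Fin n → Bool)),
        ((2 ^ n : ℝ)⁻¹ * W z.2) * ‖∑ i, sgn (z.1 i) • u z.2 i‖ := by
    have : ∀ ε : Fin n → Bool, ∑ q, ((2 ^ n : ℝ)⁻¹ * W q) * ‖∑ i, sgn (ε i) • u q i‖ =
        (2 ^ n : ℝ)⁻¹ * ∑ q, W q * ‖∑ i, u q i‖ := by
      intro ε
      rw [sum_prod_noiseWeight_eq_signed r v ε, Finset.mul_sum]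
      simp only [mul_assoc, hW, hu]
    refine ((Fintype.sum_prod_type _).trans
      ((Finset.sum_congr rfl fun ε _ => this ε).trans ?_)).symm
    rw [← Finset.sum_mul, hc, one_mul]
  have hjensen : (∑ q, W q * ‖∑ i, u q i‖) ^ p ≤
      ∑ q, W q * ((2 ^ n : ℝ)⁻¹ * ∑ ε : Fin n → Bool, ‖∑ i, sgn (ε i) • u q i‖ ^ p) := by
    rw [hsign]
    refine (Real.rpow_arith_mean_le_arith_mean_rpow _ _ _ (fun z _ => ?_) ?_
      (fun z _ => norm_nonneg _) hp1).trans_eq ?_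
    · exact mul_nonneg (by positivity) (hW0 _)
    · rw [Fintype.sum_prod_type]
      simp only [← Finset.mul_sum, hW1, mul_one, hc]
    · rw [Fintype.sum_prod_type, Finset.sum_comm]
      refine Finset.sum_congr rfl fun q _ => ?_
      simp only [Finset.mul_sum]
      exact Finset.sum_congr rfl fun ε _ => by ring
  have hmoment : ∀ i, ∑ q, W q * ‖u q i‖ ^ p ≤ (2 * L) ^ p * ((1 - r ^ 2) / 2) := by
    intro i
    have hle : ∀ q, W q * ‖u q i‖ ^ p ≤
        (2 * L) ^ p * (W q * ((1 - sgn (q.1 i) * sgn (q.2 i)) / 2)) := by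
      intro q
      have : ‖u q i‖ ^ p ≤ 2 ^ p * ((1 - sgn (q.1 i) * sgn (q.2 i)) / 2) * L ^ p := by
        rw [← abs_sgn_sub_rpow hp0, ← Real.mul_rpow (abs_nonneg _) hL, hu]
        refine Real.rpow_le_rpow (norm_nonneg _) ?_ hp0.le
        rw [norm_smul, Real.norm_eq_abs]
        exact mul_le_mul_of_nonneg_left (hv i) (abs_nonneg _)
      refine (mul_le_mul_of_nonneg_left this (hW0 q)).trans_eq ?_
      rw [Real.mul_rpow zero_le_two hL]
      ring
    refine (Finset.sum_le_sum fun q _ => hle q).trans_eq ?_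
    rw [← Finset.mul_sum]
    congr 1
    have hprod : ∑ q, W q * (sgn (q.1 i) * sgn (q.2 i)) = r ^ 2 := by
      rw [Fintype.sum_prod_type]
      have : ∀ ξ ζ : Fin n → Bool, W (ξ, ζ) * (sgn (ξ i) * sgn (ζ i)) =
          (noiseWeight r ξ * sgn (ξ i)) * (noiseWeight r ζ * sgn (ζ i)) := by
        intro ξ ζ
        simp only [hW]
        ring
      simp only [this, ← Finset.mul_sum, ← Finset.sum_mul, sum_noiseWeight_mul_sgn]
      ring
    have : ∀ q, W q * ((1 - sgn (q.1 i) * sgn (q.2 i)) / 2) =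
        (W q - W q * (sgn (q.1 i) * sgn (q.2 i))) / 2 := fun q => by ring
    simp only [this]
    rw [← Finset.sum_div, Finset.sum_sub_distrib, hW1, hprod]
  have hpow : (∑ q, W q * ‖∑ i, u q i‖) ^ p ≤
      (2 * T * L * (n : ℝ) ^ (1 / p) * √(1 - r ^ 2)) ^ p := by
    calc _ ≤ ∑ q, W q * (T ^ p * ∑ i, ‖u q i‖ ^ p) :=
          hjensen.trans (Finset.sum_le_sum fun q _ =>
            mul_le_mul_of_nonneg_left (hX n (u q)) (hW0 q))
      _ = T ^ p * ∑ i, ∑ q, W q * ‖u q i‖ ^ p := by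
          rw [Finset.sum_comm, Finset.mul_sum]
          refine Finset.sum_congr rfl fun q _ => ?_
          rw [Finset.mul_sum, Finset.mul_sum, Finset.mul_sum]
          exact Finset.sum_congr rfl fun i _ => by ring
      _ ≤ T ^ p * ∑ _i : Fin n, (2 * L) ^ p * ((1 - r ^ 2) / 2) :=
          mul_le_mul_of_nonneg_left (Finset.sum_le_sum fun i _ => hmoment i) (by positivity)
      _ = T ^ p * (2 * L) ^ p * n * ((1 - r ^ 2) / 2) := by
          rw [Finset.sum_const, Finset.card_univ, Fintype.card_fin, nsmul_eq_mul]
          ring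
      _ ≤ T ^ p * (2 * L) ^ p * n * √(1 - r ^ 2) ^ p := by
          refine mul_le_mul_of_nonneg_left ?_ (by positivity)
          rw [Real.sqrt_eq_rpow, ← Real.rpow_mul hr]
          have := Real.rpow_le_rpow_of_exponent_ge_of_imp hr (by nlinarith)
            (show 1 / 2 * p ≤ 1 by linarith) (fun _ h => by linarith)
          rw [Real.rpow_one] at this
          linarith
      _ = _ := by
          rw [Real.mul_rpow (by positivity) (Real.sqrt_nonneg _),
            Real.mul_rpow (by positivity) (Real.rpow_nonneg n.cast_nonneg _),
            ← Real.rpow_mul n.cast_nonneg,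
            one_div_mul_cancel hp0.ne', Real.rpow_one,
            show 2 * T * L = T * (2 * L) by ring, Real.mul_rpow hT.le (by positivity)]
  exact hsym.trans ((Real.rpow_le_rpow_iff
    (Finset.sum_nonneg fun q _ => mul_nonneg (hW0 q) (norm_nonneg _)) (by positivity) hp0).mp hpow)

lemma mulc_flipc (ξ x : Fin n → Bool) (i : Fin n) :
    mulc (flipc ξ i) x = flipc (mulc ξ x) i := by
  ext j
  by_cases h : j = i
  · subst h
    cases hξ : ξ j <;> cases hx : x j <;> simp [mulc, flipc, hξ, hx]
  · simp [mulc, flipc, Function.update_of_ne h]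

lemma mulc_involutive (ξ : Fin n → Bool) : Function.Involutive (mulc ξ) := by
  intro x
  ext i
  cases hξ : ξ i <;> cases hx : x i <;> simp [mulc, hξ, hx]

lemma mulc_comm (x y : Fin n → Bool) : mulc x y = mulc y x := by
  ext i
  cases hx : x i <;> cases hy : y i <;> simp [mulc, hx, hy]

lemma sum_mulc {M : Type*} [AddCommMonoid M] (ξ : Fin n → Bool) (g : (Fin n → Bool) → M) :
    ∑ x, g (mulc ξ x) = ∑ x, g x :=
  Equiv.sum_comp (mulc_involutive ξ).toPerm g

/-- The noise operator (heat semigroup) on the cube. -/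
def noiseOp (r : ℝ) (f : (Fin n → Bool) → X) (x : Fin n → Bool) : X :=
  ∑ ξ : Fin n → Bool, noiseWeight r ξ • f (mulc ξ x)

/-- The derivative of `noiseOp r f x` in `r`. -/
def noiseOpDeriv (r : ℝ) (f : (Fin n → Bool) → X) (x : Fin n → Bool) : X :=
  ∑ ξ : Fin n → Bool, (∑ i, noiseWeightDeriv r i ξ) • f (mulc ξ x)

lemma hasDerivAt_noiseOp (r : ℝ) (f : (Fin n → Bool) → X) (x : Fin n → Bool) :
    HasDerivAt (fun r => noiseOp r f x) (noiseOpDeriv r f x) r :=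
  HasDerivAt.fun_sum fun ξ _ => (hasDerivAt_noiseWeight r ξ).smul_const (f (mulc ξ x))

lemma noiseOp_zero (f : (Fin n → Bool) → X) (x : Fin n → Bool) :
    noiseOp 0 f x = (2 ^ n : ℝ)⁻¹ • ∑ y, f y := by
  unfold noiseOp
  rw [Finset.smul_sum, ← sum_mulc x]
  refine Finset.sum_congr rfl fun ξ _ => ?_
  have : mulc (mulc x ξ) x = ξ := by rw [mulc_comm, mulc_involutive x ξ]
  simp [noiseWeight, this]

lemma noiseOp_one (f : (Fin n → Bool) → X) (x : Fin n → Bool) : noiseOp 1 f x = f x := by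
  unfold noiseOp
  rw [Finset.sum_eq_single (fun _ => true)]
  · have : mulc (fun _ => true) x = x := by
      ext i
      simp [mulc]
    simp [noiseWeight, sgn, this]
  · intro ξ _ hξ
    obtain ⟨i, hi⟩ := Function.ne_iff.mp hξ
    have : noiseWeight 1 ξ = 0 := by
      refine Finset.prod_eq_zero (Finset.mem_univ i) ?_
      simp [sgn, hi]
    rw [this, zero_smul]
  · simp

lemma one_sub_sq_smul_noiseOpDeriv (r : ℝ) (f : (Fin n → Bool) → X) (x : Fin n → Bool) :
    (1 - r ^ 2) • noiseOpDeriv r f x =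
      ∑ ξ : Fin n → Bool, noiseWeight r ξ • ∑ i, (sgn (ξ i) - r) •
        ((1 / 2 : ℝ) • (f (mulc ξ x) - f (flipc (mulc ξ x) i))) := by
  unfold noiseOpDeriv
  simp only [Finset.smul_sum, Finset.sum_smul]
  rw [Finset.sum_comm, Finset.sum_comm (s := Finset.univ (α := Fin n → Bool))]
  refine Finset.sum_congr rfl fun i _ => ?_
  have h := sum_noiseWeightDeriv_smul_eq_zero r i
    (fun ξ => (1 / 2 : ℝ) • (f (mulc ξ x) + f (flipc (mulc ξ x) i)))
    (fun ξ => by simp only [mulc_flipc, flipc_flipc, add_comm])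
  have h' := congrArg ((1 - r ^ 2) • ·) h
  simp only [smul_zero, Finset.smul_sum] at h'
  rw [← sub_eq_zero, ← Finset.sum_sub_distrib, ← h']
  refine Finset.sum_congr rfl fun ξ _ => ?_
  rw [smul_smul (noiseWeight r ξ), noiseWeight_mul_sub]
  module

lemma RademacherType.sum_norm_noiseOpDeriv_le {p T : ℝ} (hp1 : 1 ≤ p) (hp2 : p ≤ 2)
    (hT : 0 < T) (hX : RademacherType X p T) {r : ℝ} (h0 : 0 ≤ r) (h1 : r < 1)
    (f : (Fin n → Bool) → X) {K : ℝ} (hK : 0 ≤ K)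
    (hf : ∀ x i, ‖f x - f (flipc x i)‖ ≤ K) :
    ∑ x, ‖noiseOpDeriv r f x‖ ≤ 2 ^ n * (T * K * (n : ℝ) ^ (1 / p)) * (1 / √(1 - r ^ 2)) := by
  have hr : 0 < 1 - r ^ 2 := by nlinarith
  have hs : 0 < √(1 - r ^ 2) := Real.sqrt_pos.mpr hr
  set v : (Fin n → Bool) → Fin n → X :=
    fun y i => (1 / 2 : ℝ) • (f y - f (flipc y i)) with hv
  have hvK : ∀ y i, ‖v y i‖ ≤ K / 2 := by
    intro y i
    rw [hv, norm_smul]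
    have := hf y i
    norm_num
    linarith
  have hmain : (1 - r ^ 2) * ∑ x, ‖noiseOpDeriv r f x‖ ≤
      2 ^ n * (T * K * (n : ℝ) ^ (1 / p)) * √(1 - r ^ 2) := by
    calc (1 - r ^ 2) * ∑ x, ‖noiseOpDeriv r f x‖
        = ∑ x, ‖(1 - r ^ 2) • noiseOpDeriv r f x‖ := by
          simp only [norm_smul, Real.norm_of_nonneg hr.le, Finset.mul_sum]
      _ ≤ ∑ x, ∑ ξ, noiseWeight r ξ * ‖∑ i, (sgn (ξ i) - r) • v (mulc ξ x) i‖ := by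
          refine Finset.sum_le_sum fun x _ => ?_
          rw [one_sub_sq_smul_noiseOpDeriv]
          refine (norm_sum_le _ _).trans_eq (Finset.sum_congr rfl fun ξ _ => ?_)
          rw [norm_smul, Real.norm_of_nonneg (noiseWeight_nonneg h0 h1.le ξ)]
      _ = ∑ y, ∑ ξ, noiseWeight r ξ * ‖∑ i, (sgn (ξ i) - r) • v y i‖ := by
          rw [Finset.sum_comm, Finset.sum_comm (s := Finset.univ) (t := Finset.univ)
            (f := fun y ξ => noiseWeight r ξ * ‖∑ i, (sgn (ξ i) - r) • v y i‖)]
          exact Finset.sum_congr rfl fun ξ _ =>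
            sum_mulc ξ (fun y => noiseWeight r ξ * ‖∑ i, (sgn (ξ i) - r) • v y i‖)
      _ ≤ ∑ _y : Fin n → Bool, 2 * T * (K / 2) * (n : ℝ) ^ (1 / p) * √(1 - r ^ 2) :=
          Finset.sum_le_sum fun y _ => hX.sum_noiseWeight_mul_norm_le hp1 hp2 hT h0 h1.le
            (v y) (by positivity) (hvK y)
      _ = _ := by
          simp
          ring
  rw [mul_one_div, le_div_iff₀ hs]
  refine le_of_mul_le_mul_right ?_ hs
  calc _ = (1 - r ^ 2) * ∑ x, ‖noiseOpDeriv r f x‖ := by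
        rw [mul_assoc, Real.mul_self_sqrt hr.le, mul_comm]
    _ ≤ _ := hmain

/-- An `L₁` Poincaré inequality on the cube for functions with values in a space of type `p`. -/
lemma RademacherType.sum_norm_sub_mean_le {p T : ℝ} (hp1 : 1 ≤ p) (hp2 : p ≤ 2)
    (hT : 0 < T) (hX : RademacherType X p T) (f : (Fin n → Bool) → X) {K : ℝ} (hK : 0 ≤ K)
    (hf : ∀ x i, ‖f x - f (flipc x i)‖ ≤ K) :
    ∑ x, ‖f x - (2 ^ n : ℝ)⁻¹ • ∑ y, f y‖ ≤ 2 ^ n * (2 * T * K * (n : ℝ) ^ (1 / p)) := by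
  set C : ℝ := 2 ^ n * (T * K * (n : ℝ) ^ (1 / p)) with hC
  have hC0 : 0 ≤ C := by positivity
  let F : ℝ → PiLp 1 (fun _ : Fin n → Bool => X) :=
    fun r => WithLp.toLp 1 (fun x => noiseOp r f x - noiseOp 0 f x)
  let F' : ℝ → PiLp 1 (fun _ : Fin n → Bool => X) :=
    fun r => WithLp.toLp 1 (fun x => noiseOpDeriv r f x)
  have hF : ∀ r, HasDerivAt F (F' r) r := by
    intro r
    have h : HasDerivAt (fun r x => noiseOp r f x - noiseOp 0 f x)
        (fun x => noiseOpDeriv r f x) r :=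
      hasDerivAt_pi.mpr fun x => (hasDerivAt_noiseOp r f x).sub_const _
    exact (PiLp.continuousLinearEquiv 1 ℝ
      (fun _ : Fin n → Bool => X)).symm.hasFDerivAt.comp_hasDerivAt r h
  have key := image_norm_le_of_norm_deriv_right_le_deriv_boundary' (a := 0) (b := 1)
    (f := F) (f' := F') (B := fun r => C * Real.arcsin r) (B' := fun r => C * (1 / √(1 - r ^ 2)))
    (fun r _ => (hF r).continuousAt.continuousWithinAt) (fun r _ => (hF r).hasDerivWithinAt)
    (by simp [F, PiLp.norm_eq_of_L1])
    (continuous_const.mul Real.continuous_arcsin).continuousOn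
    (fun r hr => ((Real.hasDerivAt_arcsin (by linarith [hr.1]) hr.2.ne).const_mul
      C).hasDerivWithinAt)
    (fun r hr => by
      rw [PiLp.norm_eq_of_L1]
      exact hX.sum_norm_noiseOpDeriv_le hp1 hp2 hT hr.1 hr.2 f hK hf)
    (Set.right_mem_Icc.mpr zero_le_one)
  simp only [F, PiLp.norm_eq_of_L1, noiseOp_one, noiseOp_zero, Real.arcsin_one] at key
  refine key.trans ?_
  calc C * (Real.pi / 2) ≤ C * 2 :=
        mul_le_mul_of_nonneg_left (by linarith [Real.pi_le_four]) hC0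
    _ = _ := by
        rw [hC]
        ring

end NoiseOperator

section Packing

variable {n : ℕ}

lemma hamming_flipc (x : Fin n → Bool) (i : Fin n) : hamming x (flipc x i) = 1 := by
  unfold hamming
  rw [Finset.card_eq_one]
  refine ⟨i, ?_⟩
  ext j
  rw [Finset.mem_filter, Finset.mem_singleton]
  by_cases h : j = i
  · subst h
    simp [flipc]
  · simp [flipc, h]

lemma hamming_negc (x : Fin n → Bool) : hamming x (negc x) = n := by
  simp [hamming, negc]

lemma sum_eighth_pow_hamming (y : Fin n → Bool) :
    ∑ x : Fin n → Bool, (1 / 8 : ℝ) ^ hamming x y = (9 / 8 : ℝ) ^ n := by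
  have h : ∀ x : Fin n → Bool,
      (1 / 8 : ℝ) ^ hamming x y = ∏ i, if x i ≠ y i then (1 / 8 : ℝ) else 1 := by
    intro x
    rw [Finset.prod_ite]
    simp [hamming]
  simp only [h]
  rw [sum_cube_prod (fun i b => if b ≠ y i then (1 / 8 : ℝ) else 1)]
  have : ∀ i : Fin n, ((if true ≠ y i then (1 / 8 : ℝ) else 1) +
      if false ≠ y i then (1 / 8 : ℝ) else 1) = 9 / 8 := by
    intro i
    cases y i <;> norm_num
  rw [Finset.prod_congr rfl fun i _ => this i]
  simp only [Finset.prod_const, Finset.card_univ, Fintype.card_fin]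

/-- Hamming balls of radius `n / 8` are exponentially small. -/
lemma card_hamming_lt_le (y : Fin n → Bool) :
    ((Finset.univ.filter fun x : Fin n → Bool => (hamming x y : ℝ) < n / 8).card : ℝ) ≤
      (3 / 2 : ℝ) ^ n := by
  set S := Finset.univ.filter fun x : Fin n → Bool => (hamming x y : ℝ) < n / 8 with hS
  have h1 : (S.card : ℝ) * (3 / 4) ^ n ≤ (9 / 8) ^ n := by
    rw [← sum_eighth_pow_hamming y, ← nsmul_eq_mul, ← Finset.sum_const]
    refine (Finset.sum_le_sum fun x hx => ?_).trans
      (Finset.sum_le_sum_of_subset_of_nonneg (Finset.subset_univ S) fun x _ _ => by positivity)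
    have hx' : (hamming x y : ℝ) < n / 8 := (Finset.mem_filter.mp hx).2
    have hle : hamming x y * 8 ≤ n := by
      have : (hamming x y : ℝ) * 8 ≤ n := by linarith
      exact_mod_cast this
    refine le_of_pow_le_pow_left₀ (n := 8) (by norm_num) (by positivity) ?_
    calc ((3 / 4 : ℝ) ^ n) ^ 8 = ((3 / 4 : ℝ) ^ 8) ^ n := by
          rw [← pow_mul, ← pow_mul, mul_comm]
      _ ≤ (1 / 8 : ℝ) ^ n := pow_le_pow_left₀ (by positivity) (by norm_num) n
      _ ≤ (1 / 8 : ℝ) ^ (hamming x y * 8) :=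
          pow_le_pow_of_le_one (by norm_num) (by norm_num) hle
      _ = _ := pow_mul _ _ _
  have h2 : (9 / 8 : ℝ) ^ n = (3 / 2) ^ n * (3 / 4) ^ n := by
    rw [← mul_pow]
    norm_num
  rw [h2] at h1
  exact le_of_mul_le_mul_right h1 (by positivity)

variable {X : Type*} [NormedAddCommGroup X] [NormedSpace ℝ X] [FiniteDimensional ℝ X]

/-- Volumetric comparison for finitely many balls of radius `a` with centers in a ball of radius
`R`, if every point is covered at most `V` times. -/
lemma card_mul_pow_le_of_multiplicity {ι : Type*} (S : Finset ι) (f : ι → X) (m : X)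
    {a R V : ℝ} (ha : 0 < a) (hR : 0 ≤ R) (hm : ∀ x ∈ S, ‖f x - m‖ ≤ R)
    (hV : ∀ z, ((S.filter fun x => ‖z - f x‖ < a).card : ℝ) ≤ V) :
    (S.card : ℝ) * a ^ Module.finrank ℝ X ≤ V * (R + a) ^ Module.finrank ℝ X := by
  let _ : MeasurableSpace X := borel X
  have _ : BorelSpace X := ⟨rfl⟩
  set μ : MeasureTheory.Measure X := MeasureTheory.Measure.addHaar
  have hV0 : 0 ≤ V := (Nat.cast_nonneg _).trans (hV 0)
  have hpt : ∀ z : X, ∑ x ∈ S, (Metric.ball (f x) a).indicator (1 : X → ENNReal) z ≤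
      ENNReal.ofReal V * (Metric.ball m (R + a)).indicator (1 : X → ENNReal) z := by
    intro z
    have hsum : ∑ x ∈ S, (Metric.ball (f x) a).indicator (1 : X → ENNReal) z =
        ((S.filter fun x => ‖z - f x‖ < a).card : ENNReal) := by
      rw [Finset.card_filter, Nat.cast_sum]
      refine Finset.sum_congr rfl fun x _ => ?_
      by_cases hx : ‖z - f x‖ < a
      · rw [if_pos hx, Set.indicator_of_mem (by rwa [Metric.mem_ball, dist_eq_norm])]
        simp
      · rw [if_neg hx, Set.indicator_of_notMem (by rwa [Metric.mem_ball, dist_eq_norm])]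
        simp
    rw [hsum]
    by_cases hz : z ∈ Metric.ball m (R + a)
    · rw [Set.indicator_of_mem hz, Pi.one_apply, mul_one]
      rw [← ENNReal.ofReal_natCast]
      exact ENNReal.ofReal_le_ofReal (hV z)
    · have : (S.filter fun x => ‖z - f x‖ < a) = ∅ := by
        refine Finset.filter_eq_empty_iff.mpr fun x hx hlt => hz ?_
        rw [Metric.mem_ball, dist_eq_norm]
        calc ‖z - m‖ ≤ ‖z - f x‖ + ‖f x - m‖ := norm_sub_le_norm_sub_add_norm_sub _ _ _
          _ < R + a := by linarith [hm x hx]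
      simp [this]
  have hint := MeasureTheory.lintegral_mono (μ := μ) hpt
  rw [MeasureTheory.lintegral_finsetSum _
      (fun x _ => measurable_one.indicator measurableSet_ball),
    MeasureTheory.lintegral_const_mul _ (measurable_one.indicator measurableSet_ball)] at hint
  simp only [MeasureTheory.lintegral_indicator_one measurableSet_ball] at hint
  simp only [MeasureTheory.Measure.addHaar_ball_of_pos μ _ ha,
    MeasureTheory.Measure.addHaar_ball_of_pos μ _ (show 0 < R + a by linarith),
    Finset.sum_const, nsmul_eq_mul, ← mul_assoc] at hint
  have hb0 : μ (Metric.ball 0 1) ≠ 0 := (Metric.measure_ball_pos μ 0 one_pos).ne'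
  have hbt : μ (Metric.ball 0 1) ≠ ⊤ := MeasureTheory.measure_ball_lt_top.ne
  rw [ENNReal.mul_le_mul_iff_left hb0 hbt, ← ENNReal.ofReal_natCast,
    ← ENNReal.ofReal_mul (Nat.cast_nonneg _), ← ENNReal.ofReal_mul hV0,
    ENNReal.ofReal_le_ofReal_iff (by positivity)] at hint
  exact hint

/-- A `θ`-snowflake co-Lipschitz image of half of the cube cannot lie in a small ball. -/
lemma pow_le_of_separated (S : Finset (Fin n → Bool)) (f : (Fin n → Bool) → X) (m : X)
    {s θ R : ℝ} (hn : 1 ≤ n) (hs : 0 < s) (hθ : 0 < θ) (hR : 0 ≤ R)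
    (hf : ∀ x y, s * (hamming x y : ℝ) ^ θ ≤ ‖f x - f y‖)
    (hm : ∀ x ∈ S, ‖f x - m‖ ≤ R) (hS : (2 : ℝ) ^ n / 2 ≤ S.card) :
    (4 / 3 : ℝ) ^ n / 2 ≤ (1 + R / (s * (n / 8 : ℝ) ^ θ / 2)) ^ Module.finrank ℝ X := by
  have hn0 : (0 : ℝ) < n := by exact_mod_cast hn
  set a : ℝ := s * (n / 8 : ℝ) ^ θ / 2 with ha_def
  have ha : 0 < a := by positivity
  have hV : ∀ z, ((S.filter fun x => ‖z - f x‖ < a).card : ℝ) ≤ (3 / 2 : ℝ) ^ n := by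
    intro z
    rcases (S.filter fun x => ‖z - f x‖ < a).eq_empty_or_nonempty with h | ⟨y, hy⟩
    · rw [h, Finset.card_empty, Nat.cast_zero]
      positivity
    · refine le_trans ?_ (card_hamming_lt_le y)
      refine Nat.cast_le.mpr (Finset.card_le_card fun x hx => ?_)
      have hx' := (Finset.mem_filter.mp hx).2
      have hy' := (Finset.mem_filter.mp hy).2
      refine Finset.mem_filter.mpr ⟨Finset.mem_univ _, ?_⟩
      by_contra! hle
      have h1 : (n / 8 : ℝ) ^ θ ≤ (hamming x y : ℝ) ^ θ :=
        Real.rpow_le_rpow (by positivity) hle hθ.le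
      have h2 := mul_le_mul_of_nonneg_left h1 hs.le
      have h3 := norm_sub_le_norm_sub_add_norm_sub (f x) z (f y)
      rw [norm_sub_rev (f x) z] at h3
      linarith [hf x y]
  have h := card_mul_pow_le_of_multiplicity S f m ha hR hm hV
  have h1 : (2 : ℝ) ^ n / 2 * a ^ Module.finrank ℝ X ≤
      (3 / 2 : ℝ) ^ n * (R + a) ^ Module.finrank ℝ X :=
    (mul_le_mul_of_nonneg_right hS (by positivity)).trans h
  have h2 : R + a = (1 + R / a) * a := by
    field_simp
    ring
  have h3 : (2 : ℝ) ^ n = (3 / 2) ^ n * (4 / 3) ^ n := by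
    rw [← mul_pow]
    norm_num
  rw [h2, mul_pow, h3] at h1
  have h4 : (0 : ℝ) < (3 / 2) ^ n * a ^ Module.finrank ℝ X := by positivity
  refine le_of_mul_le_mul_right ?_ h4
  linarith

lemma div_twelve_le_of_pow_le {n d : ℕ} (hd : 1 ≤ d) (hnd : 6 * d ≤ n) {t : ℝ} (ht : 0 ≤ t)
    (h : (4 / 3 : ℝ) ^ n / 2 ≤ (1 + t) ^ d) : (n / d : ℝ) / 12 ≤ t := by
  have hd0 : (0 : ℝ) < d := by exact_mod_cast hd
  set x : ℝ := n / d with hx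
  have hx6 : 6 ≤ x := by
    rw [hx, le_div_iff₀ hd0]
    exact_mod_cast hnd
  have hbern : 1 + x * (1 / 3) ≤ (4 / 3 : ℝ) ^ x := by
    have := one_add_mul_self_le_rpow_one_add (show (-1 : ℝ) ≤ 1 / 3 by norm_num)
      (show 1 ≤ x by linarith)
    norm_num at this ⊢
    linarith
  have hpow : (1 + x * (1 / 3)) ^ d ≤ (4 / 3 : ℝ) ^ n := by
    refine (pow_le_pow_left₀ (by positivity) hbern d).trans_eq ?_
    rw [← Real.rpow_natCast, ← Real.rpow_mul (by norm_num), hx, div_mul_cancel₀ _ hd0.ne',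
      Real.rpow_natCast]
  by_contra! hlt
  have h1 : 2 * (1 + t) < 1 + x * (1 / 3) := by linarith
  have h2 := pow_lt_pow_left₀ h1 (by positivity) (show d ≠ 0 by omega)
  rw [mul_pow] at h2
  have h3 : (2 : ℝ) ≤ 2 ^ d := by
    simpa using pow_le_pow_right₀ (show (1 : ℝ) ≤ 2 by norm_num) hd
  have h4 := mul_le_mul_of_nonneg_right h3 (show 0 ≤ (1 + t) ^ d by positivity)
  linarith

end Packing

lemma half_card_le_of_sum_le {α : Type*} [Fintype α] (g : α → ℝ) (hg : ∀ x, 0 ≤ g x) {A : ℝ}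
    (hA : 0 < A) (h : ∑ x, g x ≤ Fintype.card α * A) :
    (Fintype.card α : ℝ) / 2 ≤ ((Finset.univ.filter fun x => g x ≤ 2 * A).card : ℝ) := by
  have h1 : ((Finset.univ.filter fun x => ¬ g x ≤ 2 * A).card : ℝ) * (2 * A) ≤
      Fintype.card α * A := by
    rw [← nsmul_eq_mul, ← Finset.sum_const]
    refine (Finset.sum_le_sum fun x hx => ?_).trans
      ((Finset.sum_le_sum_of_subset_of_nonneg (Finset.subset_univ _) fun x _ _ => hg x).trans h)
    exact (not_le.mp (Finset.mem_filter.mp hx).2).le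
  have h2 : ((Finset.univ.filter fun x => g x ≤ 2 * A).card : ℝ) +
      ((Finset.univ.filter fun x => ¬ g x ≤ 2 * A).card : ℝ) = Fintype.card α := by
    exact_mod_cast Finset.card_filter_add_card_filter_not (s := Finset.univ) (fun x => g x ≤ 2 * A)
  rw [← mul_assoc] at h1
  have h3 := le_of_mul_le_mul_right h1 hA
  linarith

lemma sum_negc {n : ℕ} {M : Type*} [AddCommMonoid M] (g : (Fin n → Bool) → M) :
    ∑ x, g (negc x) = ∑ x, g x :=
  Equiv.sum_comp (Function.Involutive.toPerm negc fun x => by ext i; simp [negc]) g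

/-- Distortion lower bound for embeddings of the `θ`-snowflake of the
Hamming cube into a finite-dimensional normed space of Rademacher type `p`. -/
theorem stmt17 :
    ∃ c : ℝ, 0 < c ∧
      ∀ (p θ : ℝ), 1 ≤ p → p ≤ 2 → 0 < θ → θ < 1 →
      ∀ (X : Type) [NormedAddCommGroup X] [NormedSpace ℝ X] [FiniteDimensional ℝ X],
      1 ≤ Module.finrank ℝ X →
      ∀ T : ℝ, 0 < T → RademacherType X p T →
      ∀ n : ℕ, 1 ≤ n →
      ∀ (f : (Fin n → Bool) → X) (s D : ℝ), 0 < s → 1 ≤ D →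
      (∀ x y : Fin n → Bool,
        s * (hamming x y : ℝ) ^ θ ≤ ‖f x - f y‖ ∧
          ‖f x - f y‖ ≤ s * D * (hamming x y : ℝ) ^ θ) →
      c * (n : ℝ) ^ θ / (T * ((min n (Module.finrank ℝ X) : ℕ) : ℝ) ^ (1 / p)) ≤ D := by
  refine ⟨1 / 768, by norm_num, ?_⟩
  intro p θ hp1 hp2 hθ0 hθ1 X _ _ _ hd T hT hX n hn f s D hs hD hf
  set d := Module.finrank ℝ X with hd_def
  have hp0 : 0 < p := by linarith
  have hq0 : 0 ≤ 1 / p := by positivity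
  have hq1 : 1 / p ≤ 1 := by rwa [div_le_one hp0]
  have hn0 : (0 : ℝ) < n := by exact_mod_cast hn
  have hd0 : (0 : ℝ) < d := by exact_mod_cast hd
  have hmin0 : (0 : ℝ) < (min n d : ℕ) := by exact_mod_cast lt_min hn hd
  rw [div_le_iff₀ (by positivity)]
  set m : X := (2 ^ n : ℝ)⁻¹ • ∑ y, f y with hm
  set A : ℝ := 2 * T * (s * D) * (n : ℝ) ^ (1 / p) with hA
  have hA0 : 0 < A := by positivity
  have hpoincare : ∑ x, ‖f x - m‖ ≤ 2 ^ n * A := by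
    refine hX.sum_norm_sub_mean_le hp1 hp2 hT f (by positivity) fun x i => ?_
    simpa [hamming_flipc] using (hf x (flipc x i)).2
  by_cases hnd : 6 * d ≤ n
  · have hmin : min n d = d := min_eq_right (by omega)
    rw [hmin]
    have hhalf := half_card_le_of_sum_le (fun x => ‖f x - m‖) (fun x => norm_nonneg _) hA0
      (by simpa using hpoincare)
    have hpack := pow_le_of_separated (R := 2 * A) (Finset.univ.filter fun x => ‖f x - m‖ ≤ 2 * A)
      f m hn hs hθ0 (by positivity) (fun x y => (hf x y).1)
      (fun x hx => (Finset.mem_filter.mp hx).2) (by simpa using hhalf)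
    have hratio := div_twelve_le_of_pow_le hd hnd (by positivity) hpack
    rw [le_div_iff₀ (by positivity)] at hratio
    have h8 : (n : ℝ) ^ θ / 8 ≤ (n / 8 : ℝ) ^ θ := by
      rw [Real.div_rpow hn0.le (by norm_num)]
      refine div_le_div_of_nonneg_left (by positivity) (by positivity) ?_
      simpa using Real.rpow_le_rpow_of_exponent_le (show (1 : ℝ) ≤ 8 by norm_num) hθ1.le
    have hsplit : (n : ℝ) ^ (1 / p) ≤ n / d * (d : ℝ) ^ (1 / p) := by
      have h1 : (1 : ℝ) ≤ n / d := by
        rw [one_le_div hd0]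
        exact_mod_cast (show d ≤ n by omega)
      have h2 : (n : ℝ) ^ (1 / p) = (n / d : ℝ) ^ (1 / p) * (d : ℝ) ^ (1 / p) := by
        rw [← Real.mul_rpow (by positivity) hd0.le, div_mul_cancel₀ _ hd0.ne']
      rw [h2]
      refine mul_le_mul_of_nonneg_right ?_ (by positivity)
      simpa using Real.rpow_le_rpow_of_exponent_le h1 hq1
    have hx0 : (0 : ℝ) < n / d := by positivity
    have h1 : (n / d : ℝ) / 12 * (s * ((n : ℝ) ^ θ / 8) / 2) ≤
        2 * (2 * T * (s * D) * (n / d * (d : ℝ) ^ (1 / p))) := by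
      calc _ ≤ (n / d : ℝ) / 12 * (s * (n / 8 : ℝ) ^ θ / 2) := by gcongr
        _ ≤ 2 * A := hratio
        _ ≤ _ := by
          rw [hA]
          gcongr
    refine le_of_mul_le_mul_right ?_ (mul_pos hx0 hs)
    linarith
  · have hanti : s * (n : ℝ) ^ θ ≤ 2 * A := by
      have h1 : ∑ _x : Fin n → Bool, s * (n : ℝ) ^ θ ≤ 2 * (2 ^ n * A) := by
        calc _ ≤ ∑ x, (‖f x - m‖ + ‖f (negc x) - m‖) := by
              refine Finset.sum_le_sum fun x _ => ?_
              have h := (hf x (negc x)).1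
              rw [hamming_negc] at h
              have h' := norm_sub_le_norm_sub_add_norm_sub (f x) m (f (negc x))
              rw [norm_sub_rev m] at h'
              exact h.trans h'
          _ = 2 * ∑ x, ‖f x - m‖ := by
              rw [Finset.sum_add_distrib, sum_negc (fun x => ‖f x - m‖), two_mul]
          _ ≤ _ := by linarith
      simp only [Finset.sum_const, Finset.card_univ, Fintype.card_fun, Fintype.card_bool,
        Fintype.card_fin, nsmul_eq_mul, Nat.cast_pow, Nat.cast_ofNat] at h1
      refine le_of_mul_le_mul_left ?_ (show (0 : ℝ) < 2 ^ n by positivity)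
      linarith
    have hle : (n : ℝ) ^ (1 / p) ≤ 6 * ((min n d : ℕ) : ℝ) ^ (1 / p) := by
      calc (n : ℝ) ^ (1 / p) ≤ (6 * (min n d : ℕ) : ℝ) ^ (1 / p) := by
            refine Real.rpow_le_rpow hn0.le ?_ hq0
            exact_mod_cast (show n ≤ 6 * min n d by omega)
        _ = (6 : ℝ) ^ (1 / p) * ((min n d : ℕ) : ℝ) ^ (1 / p) :=
            Real.mul_rpow (by norm_num) hmin0.le
        _ ≤ _ := by
            refine mul_le_mul_of_nonneg_right ?_ (by positivity)
            simpa using Real.rpow_le_rpow_of_exponent_le (show (1 : ℝ) ≤ 6 by norm_num) hq1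
    have h2 : s * (n : ℝ) ^ θ ≤ 2 * (2 * T * (s * D) * (6 * ((min n d : ℕ) : ℝ) ^ (1 / p))) := by
      refine hanti.trans ?_
      rw [hA]
      gcongr
    refine le_of_mul_le_mul_right ?_ hs
    have h3 : 0 ≤ D * (T * ((min n d : ℕ) : ℝ) ^ (1 / p)) * s := by positivity
    linarith
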